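/- Let n, K ∈ ℕ with K ≥ 1, Δt > 0, ζ ∈ [1/2, 1], let M ∈ ℝ^{n×n} be symmetric positive definite and A ∈ ℝ^{n×n} symmetric positive semidefinite. Let e, ė : {0,…,K} → ℝⁿ and r : {1,…,K} → ℝⁿ satisfy e⁰ = 0, ė⁰ = 0 and, for every k ∈ {1,…,K}, the error scheme equations (1/Δt)·M(ė^k − ė^{k−1}) + A((1−ζ)e^{k−1} + ζe^k) = r^k and (1/Δt)(e^k − e^{k−1}) = (1−ζ)ė^{k−1} + ζė^k. Then the a posteriori error estimate (Σ_{k=1}^{K} ((ė^k)ᵀMė^k + (e^k)ᵀAe^k))^{1/2} ≤ 2·(Σ_{k=1}^{K} (Δt·Σ_{k'=1}^{k} ((r^{k'})ᵀM⁻¹r^{k'})^{1/2})²)^{1/2} holds. -/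

import Mathlib

open Matrix Finset

lemma aux_symm {n : ℕ} {M : Matrix (Fin n) (Fin n) ℝ} (hM : M.PosSemidef)
    (x y : Fin n → ℝ) : x ⬝ᵥ (M *ᵥ y) = y ⬝ᵥ (M *ᵥ x) := by
  have h : Mᵀ = M := by
    have := hM.isHermitian.eq
    rwa [conjTranspose_eq_transpose_of_trivial] at this
  rw [dotProduct_mulVec, ← mulVec_transpose, h, dotProduct_comm]

lemma aux_nonneg {n : ℕ} {M : Matrix (Fin n) (Fin n) ℝ} (hM : M.PosSemidef)
    (x : Fin n → ℝ) : 0 ≤ x ⬝ᵥ (M *ᵥ x) := by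
  simpa using hM.dotProduct_mulVec_nonneg x

lemma aux_cs {n : ℕ} {M : Matrix (Fin n) (Fin n) ℝ} (hM : M.PosSemidef)
    (x y : Fin n → ℝ) :
    x ⬝ᵥ (M *ᵥ y) ≤ Real.sqrt (x ⬝ᵥ (M *ᵥ x)) * Real.sqrt (y ⬝ᵥ (M *ᵥ y)) := by
  rw [← Real.sqrt_mul (aux_nonneg hM x)]
  apply Real.le_sqrt_of_sq_le
  have key : ∀ t : ℝ, 0 ≤ (y ⬝ᵥ (M *ᵥ y)) * (t * t) + (2 * (x ⬝ᵥ (M *ᵥ y))) * t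
      + x ⬝ᵥ (M *ᵥ x) := by
    intro t
    have h := aux_nonneg hM (x + t • y)
    simp only [mulVec_add, mulVec_smul, dotProduct_add, add_dotProduct, smul_dotProduct,
      dotProduct_smul, smul_eq_mul] at h
    rw [aux_symm hM y x] at h
    linarith
  have := discrim_le_zero key
  unfold discrim at this
  nlinarith

lemma aux_dual {n : ℕ} {M : Matrix (Fin n) (Fin n) ℝ} (hM : M.PosDef)
    (x r : Fin n → ℝ) :
    x ⬝ᵥ r ≤ Real.sqrt (x ⬝ᵥ (M *ᵥ x)) * Real.sqrt (r ⬝ᵥ (M⁻¹ *ᵥ r)) := by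
  have hu : IsUnit M.det := (Matrix.isUnit_iff_isUnit_det M).1 hM.isUnit
  have hr : M *ᵥ (M⁻¹ *ᵥ r) = r := by
    rw [mulVec_mulVec, Matrix.mul_nonsing_inv M hu, one_mulVec]
  have h := aux_cs hM.posSemidef x (M⁻¹ *ᵥ r)
  rw [hr, dotProduct_comm (M⁻¹ *ᵥ r) r] at h
  exact h

lemma aux_step {n : ℕ} {Δt ζ : ℝ} (hΔt : 0 < Δt) (hζ : ζ ∈ Set.Icc (1 / 2 : ℝ) 1)
    {M A : Matrix (Fin n) (Fin n) ℝ} (hM : M.PosDef) (hA : A.PosSemidef)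
    (e e' d d' r : Fin n → ℝ)
    (h1 : (1 / Δt) • (M *ᵥ (d - d')) + A *ᵥ ((1 - ζ) • e' + ζ • e) = r)
    (h2 : (1 / Δt) • (e - e') = (1 - ζ) • d' + ζ • d) :
    Real.sqrt (d ⬝ᵥ (M *ᵥ d) + e ⬝ᵥ (A *ᵥ e)) ≤
      Real.sqrt (d' ⬝ᵥ (M *ᵥ d') + e' ⬝ᵥ (A *ᵥ e')) +
        2 * (Δt * Real.sqrt (r ⬝ᵥ (M⁻¹ *ᵥ r))) := by
  obtain ⟨hz1, hz2⟩ := hζ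
  have hMs := hM.posSemidef
  have hd := aux_dual hM d r
  have hd' := aux_dual hM d' r
  have nM := aux_nonneg hMs d
  have nM' := aux_nonneg hMs d'
  have nA := aux_nonneg hA e
  have nA' := aux_nonneg hA e'
  have nDM := aux_nonneg hMs (d - d')
  have nDA := aux_nonneg hA (e - e')
  set ρ := Real.sqrt (r ⬝ᵥ (M⁻¹ *ᵥ r)) with hρ
  have nρ : 0 ≤ ρ := Real.sqrt_nonneg _
  -- energy identity
  have hid : Δt * ((1 - ζ) * (d' ⬝ᵥ r) + ζ * (d ⬝ᵥ r)) =
      ((1 - ζ) • d' + ζ • d) ⬝ᵥ (M *ᵥ (d - d')) +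
        (e - e') ⬝ᵥ (A *ᵥ ((1 - ζ) • e' + ζ • e)) := by
    have ha : (1 - ζ) * (d' ⬝ᵥ r) + ζ * (d ⬝ᵥ r) = ((1 - ζ) • d' + ζ • d) ⬝ᵥ r := by
      simp only [add_dotProduct, smul_dotProduct, smul_eq_mul]
    have hb : e - e' = Δt • ((1 - ζ) • d' + ζ • d) := by
      rw [← h2, smul_smul, mul_one_div_cancel hΔt.ne', one_smul]
    rw [ha, hb, ← h1, dotProduct_add, dotProduct_smul, smul_dotProduct]
    simp only [smul_eq_mul]
    field_simp
  simp only [mulVec_add, mulVec_sub, mulVec_smul, dotProduct_add, add_dotProduct,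
    dotProduct_sub, sub_dotProduct, smul_dotProduct,
    dotProduct_smul, smul_eq_mul] at hid nDM nDA
  rw [aux_symm hMs d' d] at hid nDM
  rw [aux_symm hA e' e] at hid nDA
  set E := Real.sqrt (d ⬝ᵥ (M *ᵥ d) + e ⬝ᵥ (A *ᵥ e)) with hE
  set E' := Real.sqrt (d' ⬝ᵥ (M *ᵥ d') + e' ⬝ᵥ (A *ᵥ e')) with hE'
  have sE : E ^ 2 = _ := Real.sq_sqrt (add_nonneg nM nA)
  have sE' : E' ^ 2 = _ := Real.sq_sqrt (add_nonneg nM' nA')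
  have pE : 0 ≤ E := Real.sqrt_nonneg _
  have pE' : 0 ≤ E' := Real.sqrt_nonneg _
  have bd : d ⬝ᵥ r ≤ E * ρ := hd.trans
    (mul_le_mul_of_nonneg_right (Real.sqrt_le_sqrt (by linarith)) nρ)
  have bd' : d' ⬝ᵥ r ≤ E' * ρ := hd'.trans
    (mul_le_mul_of_nonneg_right (Real.sqrt_le_sqrt (by linarith)) nρ)
  have hsum : (1 - ζ) * (d' ⬝ᵥ r) + ζ * (d ⬝ᵥ r) ≤ (E + E') * ρ := by
    have a1 := mul_le_mul_of_nonneg_left bd (by linarith : 0 ≤ ζ)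
    have a2 := mul_le_mul_of_nonneg_left bd' (by linarith : 0 ≤ 1 - ζ)
    have a3 := mul_nonneg (mul_nonneg pE nρ) (by linarith : 0 ≤ 1 - ζ)
    have a4 := mul_nonneg (mul_nonneg pE' nρ) (by linarith : 0 ≤ ζ)
    linarith
  have hsum2 := mul_le_mul_of_nonneg_left hsum hΔt.le
  have c1 := mul_nonneg (by linarith : 0 ≤ 2 * ζ - 1) nDM
  have c2 := mul_nonneg (by linarith : 0 ≤ 2 * ζ - 1) nDA
  have fin : E ^ 2 - E' ^ 2 ≤ 2 * (Δt * ((E + E') * ρ)) := by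
    rw [sE, sE']
    linarith
  by_contra hcon
  push Not at hcon
  have hp : 0 ≤ Δt * ρ := mul_nonneg hΔt.le nρ
  have hpos : 0 < E + E' := by linarith
  have := mul_pos hpos (sub_pos.2 hcon)
  nlinarith

/-- Global a posteriori state error estimate for the ζ-scheme
(`ζ ∈ [1/2,1]`, `M` symmetric positive definite, `A` symmetric positive
semidefinite), for trajectories with zero initial error:
`(Σ_{k=1}^{K} ((ė^k)ᵀMė^k + (e^k)ᵀAe^k))^{1/2}
  ≤ 2·(Σ_{k=1}^{K} (Δt·Σ_{k'=1}^{k} ((r^{k'})ᵀM⁻¹r^{k'})^{1/2})²)^{1/2}`. -/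
theorem error_scheme_global_apost_estimate (n K : ℕ) (hK : 1 ≤ K)
    (Δt : ℝ) (hΔt : 0 < Δt) (ζ : ℝ) (hζ : ζ ∈ Set.Icc (1 / 2 : ℝ) 1)
    (M A : Matrix (Fin n) (Fin n) ℝ) (hM : M.PosDef) (hA : A.PosSemidef)
    (e de r : ℕ → Fin n → ℝ)
    (he0 : e 0 = 0) (hde0 : de 0 = 0)
    (h1 : ∀ k, 1 ≤ k → k ≤ K →
      (1 / Δt) • (M *ᵥ (de k - de (k - 1))) +
        A *ᵥ ((1 - ζ) • e (k - 1) + ζ • e k) = r k)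
    (h2 : ∀ k, 1 ≤ k → k ≤ K →
      (1 / Δt) • (e k - e (k - 1)) = (1 - ζ) • de (k - 1) + ζ • de k) :
    Real.sqrt (∑ k ∈ Finset.Icc 1 K, (de k ⬝ᵥ (M *ᵥ de k) + e k ⬝ᵥ (A *ᵥ e k))) ≤
      2 * Real.sqrt (∑ k ∈ Finset.Icc 1 K,
        (Δt * ∑ k' ∈ Finset.Icc 1 k, Real.sqrt (r k' ⬝ᵥ (M⁻¹ *ᵥ r k'))) ^ 2) := by
  have hE : ∀ k, k ≤ K → Real.sqrt (de k ⬝ᵥ (M *ᵥ de k) + e k ⬝ᵥ (A *ᵥ e k)) ≤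
      2 * (Δt * ∑ k' ∈ Finset.Icc 1 k, Real.sqrt (r k' ⬝ᵥ (M⁻¹ *ᵥ r k'))) := by
    intro k
    induction k with
    | zero => intro _; simp [he0, hde0]
    | succ k ih =>
      intro hk
      have h := aux_step hΔt hζ hM hA (e (k + 1)) (e k) (de (k + 1)) (de k) (r (k + 1))
        (h1 (k + 1) (by omega) hk) (h2 (k + 1) (by omega) hk)
      have := ih (by omega)
      rw [Finset.sum_Icc_succ_top (by omega)]
      linarith
  apply Real.sqrt_le_iff.2
  refine ⟨by positivity, ?_⟩
  rw [mul_pow, Real.sq_sqrt (Finset.sum_nonneg fun _ _ => sq_nonneg _), Finset.mul_sum]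
  apply Finset.sum_le_sum
  intro k hk
  have h := (Real.sqrt_le_iff.1 (hE k (Finset.mem_Icc.1 hk).2)).2
  linarith
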